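/- If X₁, X₂, X₃ are standard normal random variables (with arbitrary dependence), then their coskewness E(X₁X₂X₃) satisfies −2√(2π)/π ≤ E(X₁X₂X₃) ≤ 2√(2π)/π, and these bounds are sharp. Equivalently, E(|Z|³) = 2√(2π)/π for Z ~ N(0,1). -/

import Mathlib

open MeasureTheory Set ProbabilityTheory

lemma integrable_abs_cube_gaussianReal :
    Integrable (fun z : ℝ => |z| ^ 3) (gaussianReal 0 1) := by
  simpa using (memLp_id_gaussianReal (μ := 0) (v := 1) 3).integrable_norm_pow (p := 3) (by norm_num)

lemma integral_abs_cube_gaussianReal :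
    ∫ z, |z| ^ 3 ∂(gaussianReal 0 1) = 2 * √(2 * Real.pi) / Real.pi := by
  have key : ∫ x in Ioi (0 : ℝ), x ^ 3 * Real.exp (-(1 / 2) * x ^ 2) = 2 := by
    have h := integral_rpow_mul_exp_neg_mul_rpow (p := 2) (q := 3) (b := 1 / 2)
      (by norm_num) (by norm_num) (by norm_num)
    rw [show ((3 : ℝ) + 1) / 2 = 2 by norm_num, Real.Gamma_two] at h
    simp only [Real.rpow_ofNat] at h
    rw [h, show -((3 : ℝ) + 1) / 2 = -(2 : ℝ) by norm_num, Real.rpow_neg (by norm_num),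
      Real.rpow_ofNat]
    norm_num
  rw [integral_gaussianReal_eq_integral_smul one_ne_zero]
  have habs := integral_comp_abs
    (f := fun x : ℝ => (√(2 * Real.pi))⁻¹ * (x ^ 3 * Real.exp (-(1 / 2) * x ^ 2)))
  rw [integral_const_mul (μ := volume.restrict _), key] at habs
  have hpos : 0 < √(2 * Real.pi) := by positivity
  have hsq : √(2 * Real.pi) ^ 2 = 2 * Real.pi := Real.sq_sqrt (by positivity)
  calc _ = _ := integral_congr_ae (ae_of_all _ fun x => ?_)
    _ = _ := habs
    _ = _ := ?_
  · simp only [gaussianPDFReal_def, smul_eq_mul, sq_abs, NNReal.coe_one, mul_one, sub_zero]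
    rw [show -x ^ 2 / 2 = -(1 / 2) * x ^ 2 by ring]
    ring
  · have := Real.pi_pos
    field_simp
    linarith

lemma half_smul_add_self {α : Type*} [MeasurableSpace α] (ν : Measure α) :
    (2⁻¹ : ENNReal) • (ν + ν) = ν := by
  rw [← two_smul ENNReal ν, smul_smul, ENNReal.inv_mul_cancel two_ne_zero (by simp), one_smul]

/-- Averaging a symmetric law composed with `|·|` and `-|·|` gives the law back. -/
lemma half_smul_map_abs_add_map_neg_abs {ν : Measure ℝ} (hν : ν.map (fun x => -x) = ν) :
    (2⁻¹ : ENNReal) • (ν.map (fun x => |x|) + ν.map (fun x => -|x|)) = ν := by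
  have hsum : ν.map (fun x => |x|) + ν.map (fun x => -|x|) = ν + ν.map (fun x => -x) := by
    refine Measure.ext_of_lintegral _ fun f hf => ?_
    rw [lintegral_add_measure, lintegral_add_measure, lintegral_map hf (by fun_prop),
      lintegral_map hf (by fun_prop), lintegral_map hf (by fun_prop),
      ← lintegral_add_left (by fun_prop), ← lintegral_add_left hf]
    refine lintegral_congr fun x => ?_
    rcases abs_cases x with ⟨h, -⟩ | ⟨h, -⟩ <;> simp [h, add_comm]
  rw [hsum, hν, half_smul_add_self]

/-- The equal mixture of the laws of `(Z, |Z|, Z)` and `(Z, -|Z|, -Z)` for `Z ~ N(0,1)`; its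
coordinate product is `|Z|³`. -/
noncomputable def maxCoskewnessCoupling : Measure (Fin 3 → ℝ) :=
  (2⁻¹ : ENNReal) • ((gaussianReal 0 1).map (fun z => ![z, |z|, z]) +
    (gaussianReal 0 1).map (fun z => ![z, -|z|, -z]))

lemma measurable_vec3 {f g h : ℝ → ℝ} (hf : Measurable f) (hg : Measurable g)
    (hh : Measurable h) : Measurable (fun z => ![f z, g z, h z]) := by
  refine measurable_pi_lambda _ fun i => ?_
  fin_cases i <;> simpa

lemma map_neg_standardGaussian : (gaussianReal 0 1).map (fun x => -x) = gaussianReal 0 1 := by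
  simp [gaussianReal_map_neg]

lemma map_apply_maxCoskewnessCoupling (i : Fin 3) :
    maxCoskewnessCoupling.map (fun x => x i) = gaussianReal 0 1 := by
  have h1 : Measurable (fun z : ℝ => ![z, |z|, z]) :=
    measurable_vec3 (by fun_prop) (by fun_prop) (by fun_prop)
  have h2 : Measurable (fun z : ℝ => ![z, -|z|, -z]) :=
    measurable_vec3 (by fun_prop) (by fun_prop) (by fun_prop)
  rw [maxCoskewnessCoupling, Measure.map_smul, Measure.map_add _ _ (by fun_prop),
    Measure.map_map (by fun_prop) h1, Measure.map_map (by fun_prop) h2]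
  fin_cases i
  · simpa [Function.comp_def] using half_smul_add_self _
  · simpa [Function.comp_def] using half_smul_map_abs_add_map_neg_abs map_neg_standardGaussian
  · simpa [Function.comp_def, map_neg_standardGaussian] using half_smul_add_self _

lemma isProbabilityMeasure_of_map_eq_gaussianReal {α : Type*} [MeasurableSpace α]
    {P : Measure α} {f : α → ℝ} (h : P.map f = gaussianReal 0 1) :
    IsProbabilityMeasure P := by
  have : IsProbabilityMeasure (P.map f) := h ▸ inferInstance
  exact Measure.isProbabilityMeasure_of_map f

lemma abs_prod_le (x : Fin 3 → ℝ) : |∏ i, x i| ≤ (∑ i, |x i| ^ 3) / 3 := by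
  simp only [Fin.prod_univ_three, Fin.sum_univ_three, abs_mul]
  have ha := abs_nonneg (x 0)
  have hb := abs_nonneg (x 1)
  have hc := abs_nonneg (x 2)
  nlinarith [mul_nonneg (add_nonneg (add_nonneg ha hb) hc)
    (add_nonneg (add_nonneg (sq_nonneg (|x 0| - |x 1|)) (sq_nonneg (|x 1| - |x 2|)))
      (sq_nonneg (|x 2| - |x 0|)))]

lemma integrable_prod_maxCoskewnessCoupling :
    Integrable (fun x => ∏ i, x i) maxCoskewnessCoupling := by
  have hcube (i : Fin 3) : Integrable (fun x => |x i| ^ 3) maxCoskewnessCoupling :=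
    (map_apply_maxCoskewnessCoupling i ▸ integrable_abs_cube_gaussianReal :
      Integrable (fun z : ℝ => |z| ^ 3)
        (maxCoskewnessCoupling.map fun x => x i)).comp_measurable (by fun_prop)
  exact ((integrable_finsetSum _ fun i _ => hcube i).div_const 3).mono'
    (by fun_prop) (ae_of_all _ abs_prod_le)

lemma integral_prod_maxCoskewnessCoupling :
    ∫ x, ∏ i, x i ∂maxCoskewnessCoupling = 2 * √(2 * Real.pi) / Real.pi := by
  have h1 : Measurable (fun z : ℝ => ![z, |z|, z]) :=
    measurable_vec3 (by fun_prop) (by fun_prop) (by fun_prop)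
  have h2 : Measurable (fun z : ℝ => ![z, -|z|, -z]) :=
    measurable_vec3 (by fun_prop) (by fun_prop) (by fun_prop)
  have hm : Measurable (fun x : Fin 3 → ℝ => ∏ i, x i) := by fun_prop
  have e1 (z : ℝ) : ∏ i, ![z, |z|, z] i = |z| ^ 3 := by
    simp only [Fin.prod_univ_three, Matrix.cons_val]
    rw [pow_succ, sq_abs]; ring
  have e2 (z : ℝ) : ∏ i, ![z, -|z|, -z] i = |z| ^ 3 := by
    simp only [Fin.prod_univ_three, Matrix.cons_val]
    rw [pow_succ, sq_abs]; ring
  have i1 : Integrable (fun x => ∏ i, x i) ((gaussianReal 0 1).map fun z => ![z, |z|, z]) := by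
    rw [integrable_map_measure hm.aestronglyMeasurable h1.aemeasurable]
    simpa only [Function.comp_def, e1] using integrable_abs_cube_gaussianReal
  have i2 : Integrable (fun x => ∏ i, x i) ((gaussianReal 0 1).map fun z => ![z, -|z|, -z]) := by
    rw [integrable_map_measure hm.aestronglyMeasurable h2.aemeasurable]
    simpa only [Function.comp_def, e2] using integrable_abs_cube_gaussianReal
  rw [maxCoskewnessCoupling, integral_smul_measure, integral_add_measure i1 i2,
    integral_map h1.aemeasurable hm.aestronglyMeasurable,
    integral_map h2.aemeasurable hm.aestronglyMeasurable]
  simp only [e1, e2, integral_abs_cube_gaussianReal, ENNReal.toReal_inv, ENNReal.toReal_ofNat,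
    smul_eq_mul]
  ring

lemma abs_integral_prod_le {Ω : Type*} [MeasurableSpace Ω] {μ : Measure Ω}
    {X : Fin 3 → Ω → ℝ} (hm : ∀ i, Measurable (X i))
    (hdist : ∀ i, μ.map (X i) = gaussianReal 0 1) :
    |∫ ω, ∏ i, X i ω ∂μ| ≤ 2 * √(2 * Real.pi) / Real.pi := by
  have hint (i : Fin 3) : Integrable (fun ω => |X i ω| ^ 3) μ :=
    (hdist i ▸ integrable_abs_cube_gaussianReal :
      Integrable (fun z : ℝ => |z| ^ 3) (μ.map (X i))).comp_measurable (hm i)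
  have hval (i : Fin 3) : ∫ ω, |X i ω| ^ 3 ∂μ = 2 * √(2 * Real.pi) / Real.pi := by
    rw [← integral_abs_cube_gaussianReal, ← hdist i,
      integral_map (hm i).aemeasurable (by fun_prop)]
  have hsum : Integrable (fun ω => (∑ i, |X i ω| ^ 3) / 3) μ :=
    (integrable_finsetSum _ fun i _ => hint i).div_const 3
  rw [← Real.norm_eq_abs]
  calc ‖∫ ω, ∏ i, X i ω ∂μ‖ ≤ ∫ ω, (∑ i, |X i ω| ^ 3) / 3 ∂μ :=
        norm_integral_le_of_norm_le hsum (ae_of_all _ fun ω => abs_prod_le fun i => X i ω)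
    _ = 2 * √(2 * Real.pi) / Real.pi := by
        rw [integral_div, integral_finsetSum _ fun i _ => hint i]
        simp only [hval, Fin.sum_univ_three]
        ring


/-- For standard normal `X₁, X₂, X₃` with arbitrary dependence,
`−2√(2π)/π ≤ E(X₁X₂X₃) ≤ 2√(2π)/π`, both bounds are attained, and
`E(|Z|³) = 2√(2π)/π` for `Z ~ N(0,1)`. -/
theorem stmt_17 {Ω : Type*} [MeasurableSpace Ω] (μ : Measure Ω) [IsProbabilityMeasure μ]
    (X : Fin 3 → Ω → ℝ) (hm : ∀ i, Measurable (X i))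
    (hdist : ∀ i, μ.map (X i) = gaussianReal 0 1)
    (hInt : Integrable (fun ω => ∏ i, X i ω) μ) :
    (-(2 * Real.sqrt (2 * Real.pi) / Real.pi) ≤ ∫ ω, ∏ i, X i ω ∂μ ∧
      ∫ ω, ∏ i, X i ω ∂μ ≤ 2 * Real.sqrt (2 * Real.pi) / Real.pi) ∧
    (∃ P : Measure (Fin 3 → ℝ), IsProbabilityMeasure P ∧
        (∀ i, P.map (fun x => x i) = gaussianReal 0 1) ∧
        Integrable (fun x => ∏ i, x i) P ∧
        ∫ x, ∏ i, x i ∂P = 2 * Real.sqrt (2 * Real.pi) / Real.pi) ∧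
    (∃ P : Measure (Fin 3 → ℝ), IsProbabilityMeasure P ∧
        (∀ i, P.map (fun x => x i) = gaussianReal 0 1) ∧
        Integrable (fun x => ∏ i, x i) P ∧
        ∫ x, ∏ i, x i ∂P = -(2 * Real.sqrt (2 * Real.pi) / Real.pi)) ∧
    (∫ z, |z| ^ 3 ∂(gaussianReal 0 1) = 2 * Real.sqrt (2 * Real.pi) / Real.pi) := by
  have hneg : Measurable (fun x : Fin 3 → ℝ => fun i => -x i) := by fun_prop
  have hprod (x : Fin 3 → ℝ) : ∏ i, -x i = -∏ i, x i := by simp [Fin.prod_univ_three]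
  have hmarg (i : Fin 3) : (maxCoskewnessCoupling.map fun x i => -x i).map (fun x => x i) =
      gaussianReal 0 1 := by
    rw [Measure.map_map (by fun_prop) hneg, ← map_neg_standardGaussian,
      ← map_apply_maxCoskewnessCoupling i, Measure.map_map (by fun_prop) (by fun_prop)]
    rfl
  refine ⟨abs_le.mp (abs_integral_prod_le hm hdist),
    ⟨maxCoskewnessCoupling,
      isProbabilityMeasure_of_map_eq_gaussianReal
        (map_apply_maxCoskewnessCoupling 0),
      map_apply_maxCoskewnessCoupling, integrable_prod_maxCoskewnessCoupling,
      integral_prod_maxCoskewnessCoupling⟩,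
    ⟨maxCoskewnessCoupling.map fun x i => -x i,
      isProbabilityMeasure_of_map_eq_gaussianReal (hmarg 0), hmarg, ?_, ?_⟩,
    integral_abs_cube_gaussianReal⟩
  · rw [integrable_map_measure (by fun_prop) hneg.aemeasurable]
    simpa only [Function.comp_def, hprod] using integrable_prod_maxCoskewnessCoupling.fun_neg
  · rw [integral_map hneg.aemeasurable (by fun_prop)]
    simp only [hprod, integral_neg, integral_prod_maxCoskewnessCoupling]
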